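/- The zero set of a real-analytic function on ℝⁿ that is not identically zero on a connected open set has Lebesgue measure zero. -/

import Mathlib

open MeasureTheory

/-- Local version: on a convex open set, when `f p ≠ 0`. -/
theorem zero_set_aux (n : ℕ) (B : Set (EuclideanSpace ℝ (Fin n)))
    (hB : IsOpen B) (hBc : Convex ℝ B)
    (f : EuclideanSpace ℝ (Fin n) → ℝ) (hf : AnalyticOnNhd ℝ f B)
    (p : EuclideanSpace ℝ (Fin n)) (hp : p ∈ B) (hfp : f p ≠ 0) :
    volume {x ∈ B | f x = 0} = 0 := by
  set Z : Set (EuclideanSpace ℝ (Fin n)) := {x ∈ B | f x = 0} with hZ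
  have hZm : MeasurableSet Z := by
    have h1 : IsOpen (B ∩ f ⁻¹' {0}ᶜ) :=
      hf.continuousOn.isOpen_inter_preimage hB isOpen_compl_singleton
    have h2 : Z = B \ (B ∩ f ⁻¹' {0}ᶜ) := by
      ext x
      simp [hZ]
    rw [h2]
    exact hB.measurableSet.diff h1.measurableSet
  -- translate
  set W : Set (EuclideanSpace ℝ (Fin n)) := (fun x => p + x) ⁻¹' Z with hW
  have hWm : MeasurableSet W := (measurable_const_add p) hZm
  have hWZ : volume W = volume Z := measure_preimage_add volume p Z
  -- lines through `p`
  have hline : ∀ x : EuclideanSpace ℝ (Fin n), volume {t : ℝ | t • x ∈ W} = 0 := by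
    intro x
    set L : Set ℝ := {t : ℝ | p + t • x ∈ B} with hL
    have hLo : IsOpen L := hB.preimage (by fun_prop : Continuous fun t : ℝ => p + t • x)
    have hLc : Convex ℝ L := by
      intro s hs t ht a b ha hb hab
      have := hBc hs ht ha hb hab
      have e : p + (a • s + b • t) • x = a • (p + s • x) + b • (p + t • x) := by
        have : p = (a + b) • p := by rw [hab, one_smul]
        nth_rewrite 1 [this]
        simp only [smul_eq_mul]
        module
      show p + (a • s + b • t) • x ∈ B
      rw [e]
      exact this
    have h0 : (0 : ℝ) ∈ L := by simpa [hL] using hp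
    have hg : AnalyticOnNhd ℝ (fun t : ℝ => f (p + t • x)) L := by
      intro t ht
      have h1 : AnalyticAt ℝ (fun t : ℝ => p + t • x) t := by fun_prop
      exact AnalyticAt.comp (f := fun t : ℝ => p + t • x) (g := f) (hf _ ht) h1
    have hcod := hg.preimage_zero_mem_codiscreteWithin (x := 0) (by simpa using hfp) h0
      ⟨⟨0, h0⟩, hLc.isPreconnected⟩
    have hae := ae_restrict_le_codiscreteWithin (μ := volume) hLo.measurableSet hcod
    rw [mem_ae_iff, Measure.restrict_apply₀' hLo.measurableSet.nullMeasurableSet] at hae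
    refine measure_mono_null ?_ hae
    intro t ht
    refine ⟨?_, ht.1⟩
    have h2 : f (p + t • x) = 0 := ht.2
    simp [h2]
  -- Fubini
  set S : Set (EuclideanSpace ℝ (Fin n) × ℝ) := {q | q.2 • q.1 ∈ W} with hS
  have hSm : MeasurableSet S := (by fun_prop : Measurable
    fun q : EuclideanSpace ℝ (Fin n) × ℝ => q.2 • q.1) hWm
  have hS0 : (volume.prod volume) S = 0 := by
    rw [Measure.measure_prod_null hSm]
    exact Filter.Eventually.of_forall hline
  have hS1 : (volume.prod volume) (Prod.swap ⁻¹' S) = 0 := by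
    rw [← Measure.map_apply measurable_swap hSm, Measure.prod_swap, hS0]
  have hae := Measure.measure_ae_null_of_prod_null hS1
  have hne : ∀ᵐ t : ℝ, t ≠ 0 := by
    simp [ae_iff]
  obtain ⟨t, ht, ht0⟩ := (hae.and hne).exists
  have ht' : volume ((fun x : EuclideanSpace ℝ (Fin n) => t • x) ⁻¹' W) = 0 := ht
  rw [Measure.addHaar_preimage_smul volume ht0, mul_eq_zero] at ht'
  rw [← hWZ]
  refine ht'.resolve_left ?_
  have : 0 < |(t ^ Module.finrank ℝ (EuclideanSpace ℝ (Fin n)))⁻¹| := by positivity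
  simpa using this

/-- The zero set of a real-analytic function, not identically zero on a connected open
set `U ⊆ ℝⁿ`, has Lebesgue measure zero. -/
theorem zero_set_of_analytic_null (n : ℕ) (U : Set (EuclideanSpace ℝ (Fin n)))
    (hU : IsOpen U) (hUconn : IsConnected U)
    (f : EuclideanSpace ℝ (Fin n) → ℝ) (hf : AnalyticOnNhd ℝ f U)
    (hne : ∃ x ∈ U, f x ≠ 0) :
    volume {x ∈ U | f x = 0} = 0 := by
  refine measure_null_of_locally_null _ fun x hx => ?_
  obtain ⟨r, hr, hrU⟩ := Metric.isOpen_iff.1 hU x hx.1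
  obtain ⟨p, hp, hfp⟩ : ∃ p ∈ Metric.ball x r, f p ≠ 0 := by
    by_contra! hcon
    obtain ⟨y, hy, hfy⟩ := hne
    refine hfy (hf.eqOn_zero_of_preconnected_of_eventuallyEq_zero hUconn.isPreconnected hx.1 ?_ hy)
    filter_upwards [Metric.ball_mem_nhds x hr] with z hz using hcon z hz
  refine ⟨{z ∈ Metric.ball x r | f z = 0}, ?_, zero_set_aux n _ Metric.isOpen_ball
    (convex_ball x r) f (hf.mono hrU) p hp hfp⟩
  filter_upwards [self_mem_nhdsWithin, mem_nhdsWithin_of_mem_nhds (Metric.ball_mem_nhds x hr)]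
    with z hz hzb using ⟨hzb, hz.2⟩
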